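/- Under the assumptions of the MLE bound lemma (‖V_n^{-1}S_n‖ ≤ 1/(3 L_c L_λ)), the maximum of the log capital process satisfies e^{-C‖V_n^{-1}S_n‖} ≤ (max_θ log K_n^θ)/( (1/2) S_n' V_n^{-1} S_n) ≤ e^{C‖V_n^{-1}S_n‖}, where C = 3 L_c L_λ. -/

import Mathlib

open Real RealInnerProductSpace Finset Matrix

/-- centered log-mgf of a Bernoulli variable -/
noncomputable def phiB (p t : ℝ) : ℝ := Real.log (1 + p * (Real.exp t - 1)) - p * t

noncomputable def phiB1 (p t : ℝ) : ℝ := p * Real.exp t / (1 + p * (Real.exp t - 1)) - p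

noncomputable def phiB2 (p t : ℝ) : ℝ :=
  p * (1 - p) * (Real.exp t / (1 + p * (Real.exp t - 1)) ^ 2)

lemma den_pos {p : ℝ} (hp : p ∈ Set.Ioo (0:ℝ) 1) (t : ℝ) : 0 < 1 + p * (Real.exp t - 1) := by
  have h1 := hp.1
  have h2 := hp.2
  have := mul_pos h1 (Real.exp_pos t)
  nlinarith

lemma phiB_hasDerivAt {p : ℝ} (hp : p ∈ Set.Ioo (0:ℝ) 1) (t : ℝ) :
    HasDerivAt (phiB p) (phiB1 p t) t := by
  have hd := den_pos hp t
  have h1 : HasDerivAt (fun t => 1 + p * (Real.exp t - 1)) (p * Real.exp t) t :=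
    (((Real.hasDerivAt_exp t).sub_const 1).const_mul p).const_add 1
  have h2 := (h1.log hd.ne').sub ((hasDerivAt_id t).const_mul p)
  exact h2.congr_deriv (by simp [phiB1])

lemma phiB1_hasDerivAt {p : ℝ} (hp : p ∈ Set.Ioo (0:ℝ) 1) (t : ℝ) :
    HasDerivAt (phiB1 p) (phiB2 p t) t := by
  have hd := den_pos hp t
  have h1 : HasDerivAt (fun t => 1 + p * (Real.exp t - 1)) (p * Real.exp t) t :=
    (((Real.hasDerivAt_exp t).sub_const 1).const_mul p).const_add 1
  have h2 := (((Real.hasDerivAt_exp t).const_mul p).div h1 hd.ne').sub_const p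
  have h3 : phiB2 p t = (p * Real.exp t * (1 + p * (Real.exp t - 1)) -
      p * Real.exp t * (p * Real.exp t)) / (1 + p * (Real.exp t - 1)) ^ 2 := by
    unfold phiB2; ring
  rw [h3]
  exact h2

lemma phiB_zero (p : ℝ) : phiB p 0 = 0 := by simp [phiB]

lemma phiB1_zero (p : ℝ) : phiB1 p 0 = 0 := by simp [phiB1]

lemma phiB_neg {p : ℝ} (hp : p ∈ Set.Ioo (0:ℝ) 1) (t : ℝ) : phiB p (-t) = phiB (1 - p) t := by
  have hd := den_pos hp (-t)
  have h : 1 + (1 - p) * (Real.exp t - 1) = (1 + p * (Real.exp (-t) - 1)) * Real.exp t := by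
    have : Real.exp (-t) * Real.exp t = 1 := by rw [← Real.exp_add]; simp
    linear_combination (-p) * this
  unfold phiB
  rw [h, Real.log_mul hd.ne' (Real.exp_pos t).ne', Real.log_exp]
  ring

lemma nonneg_of_second {F F1 F2 : ℝ → ℝ} {T : ℝ} (hT : 0 ≤ T)
    (h0 : F 0 = 0) (h1 : F1 0 = 0) (hF : ∀ t, HasDerivAt F (F1 t) t)
    (hF1 : ∀ t, HasDerivAt F1 (F2 t) t) (hpos : ∀ s, 0 ≤ s → s ≤ T → 0 ≤ F2 s) : 0 ≤ F T := by
  have key : ∀ (G G' : ℝ → ℝ), G 0 = 0 → (∀ t, HasDerivAt G (G' t) t) →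
      (∀ s, 0 ≤ s → s ≤ T → 0 ≤ G' s) → ∀ s, 0 ≤ s → s ≤ T → 0 ≤ G s := by
    intro G G' hG0 hG hG' s hs hsT
    have hm : MonotoneOn G (Set.Icc 0 T) := by
      apply monotoneOn_of_deriv_nonneg (convex_Icc 0 T)
      · exact fun t _ => (hG t).continuousAt.continuousWithinAt
      · exact fun t _ => (hG t).differentiableAt.differentiableWithinAt
      · intro t ht
        rw [interior_Icc] at ht
        rw [(hG t).deriv]
        exact hG' t ht.1.le ht.2.le
    have := hm ⟨le_refl 0, hT⟩ ⟨hs, hsT⟩ hs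
    rwa [hG0] at this
  exact key F F1 h0 hF (key F1 F2 h1 hF1 hpos) T hT le_rfl

lemma ratio_bounds {p : ℝ} (hp : p ∈ Set.Ioo (0:ℝ) 1) {s : ℝ} (hs : 0 ≤ s) :
    Real.exp (-s) ≤ Real.exp s / (1 + p * (Real.exp s - 1)) ^ 2 ∧
    Real.exp s / (1 + p * (Real.exp s - 1)) ^ 2 ≤ Real.exp s := by
  have hd := den_pos hp s
  have h1 := hp.1
  have h2 := hp.2
  have he : 1 ≤ Real.exp s := Real.one_le_exp hs
  have hD1 : 1 ≤ 1 + p * (Real.exp s - 1) := by nlinarith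
  have hD2 : 1 + p * (Real.exp s - 1) ≤ Real.exp s := by nlinarith
  constructor
  · rw [le_div_iff₀ (by positivity), Real.exp_neg, inv_mul_le_iff₀ (by positivity)]
    nlinarith
  · apply div_le_self (by positivity)
    nlinarith

lemma phiB_upper_pos {p : ℝ} (hp : p ∈ Set.Ioo (0:ℝ) 1) {T : ℝ} (hT : 0 ≤ T) :
    phiB p T ≤ p * (1 - p) * (Real.exp T * T ^ 2 / 2) := by
  have hm : 0 < p * (1 - p) := mul_pos hp.1 (by linarith [hp.2])
  have := nonneg_of_second (F := fun s => p * (1 - p) * (Real.exp T * s ^ 2 / 2) - phiB p s)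
    (F1 := fun s => p * (1 - p) * (Real.exp T * s) - phiB1 p s)
    (F2 := fun s => p * (1 - p) * Real.exp T - phiB2 p s) hT (by simp [phiB_zero])
    (by simp [phiB1_zero])
    (fun t => by
      have h := ((((hasDerivAt_pow 2 t).const_mul (Real.exp T)).div_const 2).const_mul
        (p * (1 - p))).sub (phiB_hasDerivAt hp t)
      exact h.congr_deriv (by norm_num only [Nat.cast_ofNat]; ring))
    (fun t => by
      have h := (((hasDerivAt_id t).const_mul (Real.exp T)).const_mul
        (p * (1 - p))).sub (phiB1_hasDerivAt hp t)
      exact h.congr_deriv (by simp))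
    (fun s hs hsT => by
      have h := (ratio_bounds hp hs).2.trans (Real.exp_le_exp.2 hsT)
      have := mul_le_mul_of_nonneg_left h hm.le
      unfold phiB2
      linarith)
  linarith

lemma phiB_lower_pos {p : ℝ} (hp : p ∈ Set.Ioo (0:ℝ) 1) {T a : ℝ} (hT : 0 ≤ T) (ha : T ≤ a) :
    p * (1 - p) * (Real.exp (-a) * T ^ 2 / 2) ≤ phiB p T := by
  have hm : 0 < p * (1 - p) := mul_pos hp.1 (by linarith [hp.2])
  have := nonneg_of_second (F := fun s => phiB p s - p * (1 - p) * (Real.exp (-a) * s ^ 2 / 2))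
    (F1 := fun s => phiB1 p s - p * (1 - p) * (Real.exp (-a) * s))
    (F2 := fun s => phiB2 p s - p * (1 - p) * Real.exp (-a)) hT (by simp [phiB_zero])
    (by simp [phiB1_zero])
    (fun t => by
      have h := (phiB_hasDerivAt hp t).sub
        ((((hasDerivAt_pow 2 t).const_mul (Real.exp (-a))).div_const 2).const_mul (p * (1 - p)))
      exact h.congr_deriv (by norm_num only [Nat.cast_ofNat]; ring))
    (fun t => by
      have h := (phiB1_hasDerivAt hp t).sub
        (((hasDerivAt_id t).const_mul (Real.exp (-a))).const_mul (p * (1 - p)))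
      exact h.congr_deriv (by simp))
    (fun s hs hsT => by
      have h := (Real.exp_le_exp.2 (show -a ≤ -s by linarith)).trans (ratio_bounds hp hs).1
      have := mul_le_mul_of_nonneg_left h hm.le
      unfold phiB2
      linarith)
  linarith

lemma exp_neg_lower {s : ℝ} (hs : 0 ≤ s) (h1 : s ≤ 1) : 1 - s + s ^ 2 / 4 ≤ Real.exp (-s) := by
  have h := Real.exp_bound (x := -s) (by rw [abs_neg, abs_of_nonneg hs]; exact h1)
    (n := 3) (by norm_num)
  rw [abs_neg, abs_of_nonneg hs] at h
  have h2 := (abs_le.1 h).1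
  simp [Finset.sum_range_succ, Nat.factorial] at h2
  nlinarith [mul_nonneg (sq_nonneg s) (sub_nonneg.2 h1)]

lemma phiB_lower2_pos {p : ℝ} (hp : p ∈ Set.Ioo (0:ℝ) 1) {T : ℝ} (hT : 0 ≤ T) (h1 : T ≤ 1) :
    p * (1 - p) * (17 / 48 * T ^ 2) ≤ phiB p T := by
  have hm : 0 < p * (1 - p) := mul_pos hp.1 (by linarith [hp.2])
  have := nonneg_of_second
    (F := fun s => phiB p s - p * (1 - p) * (s ^ 2 / 2 - s ^ 3 / 6 + s ^ 4 / 48))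
    (F1 := fun s => phiB1 p s - p * (1 - p) * (s - s ^ 2 / 2 + s ^ 3 / 12))
    (F2 := fun s => phiB2 p s - p * (1 - p) * (1 - s + s ^ 2 / 4)) hT (by simp [phiB_zero])
    (by simp [phiB1_zero])
    (fun t => by
      have h := (phiB_hasDerivAt hp t).sub
        (((((hasDerivAt_pow 2 t).div_const 2).sub ((hasDerivAt_pow 3 t).div_const 6)).add
          ((hasDerivAt_pow 4 t).div_const 48)).const_mul (p * (1 - p)))
      exact h.congr_deriv (by norm_num only [Nat.cast_ofNat]; ring))
    (fun t => by
      have h := (phiB1_hasDerivAt hp t).sub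
        ((((hasDerivAt_id t).sub ((hasDerivAt_pow 2 t).div_const 2)).add
          ((hasDerivAt_pow 3 t).div_const 12)).const_mul (p * (1 - p)))
      exact h.congr_deriv (by norm_num only [Nat.cast_ofNat]; ring))
    (fun s hs hsT => by
      have h := (exp_neg_lower hs (hsT.trans h1)).trans (ratio_bounds hp hs).1
      have := mul_le_mul_of_nonneg_left h hm.le
      unfold phiB2
      linarith)
  have h3 : 17 / 48 * T ^ 2 ≤ T ^ 2 / 2 - T ^ 3 / 6 + T ^ 4 / 48 := by
    have : 0 ≤ T ^ 2 * ((1 - T) * (7 - T)) :=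
      mul_nonneg (sq_nonneg T) (mul_nonneg (by linarith) (by linarith))
    nlinarith
  have := mul_le_mul_of_nonneg_left h3 hm.le
  linarith

lemma one_sub_mem {p : ℝ} (hp : p ∈ Set.Ioo (0:ℝ) 1) : 1 - p ∈ Set.Ioo (0:ℝ) 1 :=
  ⟨by linarith [hp.2], by linarith [hp.1]⟩

/-- reduce a statement about `t` to a statement about `|t|` -/
lemma phiB_abs {p : ℝ} (hp : p ∈ Set.Ioo (0:ℝ) 1) (t : ℝ) :
    ∃ q, q ∈ Set.Ioo (0:ℝ) 1 ∧ q * (1 - q) = p * (1 - p) ∧ phiB p t = phiB q |t| := by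
  rcases le_total 0 t with h | h
  · exact ⟨p, hp, rfl, by rw [abs_of_nonneg h]⟩
  · refine ⟨1 - p, one_sub_mem hp, by ring, ?_⟩
    rw [abs_of_nonpos h, ← phiB_neg hp, neg_neg]

lemma phiB_upper {p : ℝ} (hp : p ∈ Set.Ioo (0:ℝ) 1) {t a : ℝ} (ha : |t| ≤ a) :
    phiB p t ≤ p * (1 - p) * (Real.exp a * t ^ 2 / 2) := by
  obtain ⟨q, hq, h1, h2⟩ := phiB_abs hp t
  have hm : 0 < p * (1 - p) := mul_pos hp.1 (by linarith [hp.2])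
  have := phiB_upper_pos hq (abs_nonneg t)
  rw [h2]
  rw [h1, sq_abs] at this
  refine this.trans ?_
  gcongr

lemma phiB_lower {p : ℝ} (hp : p ∈ Set.Ioo (0:ℝ) 1) {t a : ℝ} (ha : |t| ≤ a) :
    p * (1 - p) * (Real.exp (-a) * t ^ 2 / 2) ≤ phiB p t := by
  obtain ⟨q, hq, h1, h2⟩ := phiB_abs hp t
  have := phiB_lower_pos hq (abs_nonneg t) ha
  rw [h2]
  rwa [h1, sq_abs] at this

lemma phiB_lower2 {p : ℝ} (hp : p ∈ Set.Ioo (0:ℝ) 1) {t : ℝ} (ha : |t| ≤ 1) :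
    p * (1 - p) * (17 / 48 * t ^ 2) ≤ phiB p t := by
  obtain ⟨q, hq, h1, h2⟩ := phiB_abs hp t
  have := phiB_lower2_pos hq (abs_nonneg t) ha
  rw [h2]
  rwa [h1, sq_abs] at this

lemma phiB_smul {p : ℝ} (hp : p ∈ Set.Ioo (0:ℝ) 1) {s : ℝ} (hs : 0 ≤ s) (hs1 : s ≤ 1) (t : ℝ) :
    phiB p (s * t) ≤ s * phiB p t := by
  have hm : 0 < p * (1 - p) := mul_pos hp.1 (by linarith [hp.2])
  have hd : deriv (phiB p) = phiB1 p := funext fun t => (phiB_hasDerivAt hp t).deriv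
  have hmono : Monotone (phiB1 p) := by
    apply monotone_of_deriv_nonneg (fun t => (phiB1_hasDerivAt hp t).differentiableAt)
    intro t
    rw [(phiB1_hasDerivAt hp t).deriv]
    have := den_pos hp t
    unfold phiB2
    positivity
  have hc : ConvexOn ℝ Set.univ (phiB p) := by
    apply Monotone.convexOn_univ_of_deriv (fun t => (phiB_hasDerivAt hp t).differentiableAt)
    rw [hd]; exact hmono
  have := hc.2 (Set.mem_univ t) (Set.mem_univ 0) hs (sub_nonneg.2 hs1) (by ring)
  simpa [phiB_zero] using this

lemma num_ineq {r : ℝ} (hr : 0 ≤ r) (hr1 : r ≤ 1 / 3) : Real.exp (-(3 * r)) ≤ 2 - Real.exp r := by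
  have h1 : Real.exp r ≤ 1 + r + r ^ 2 := by
    have := Real.abs_exp_sub_one_sub_id_le (x := r) (by rw [abs_of_nonneg hr]; linarith)
    linarith [(abs_le.1 this).2]
  have h2 : Real.exp (-(3 * r)) ≤ 1 / (1 + 3 * r) := by
    rw [Real.exp_neg, ← one_div]
    apply one_div_le_one_div_of_le (by linarith)
    linarith [Real.add_one_le_exp (3 * r)]
  have h3 : 1 / (1 + 3 * r) ≤ 1 - r - r ^ 2 := by
    rw [div_le_iff₀ (by linarith)]
    have h5 : 0 ≤ r * (1 / 3 - r) := mul_nonneg hr (by linarith)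
    have : 0 ≤ r * (2 - 4 * r - 3 * r ^ 2) := mul_nonneg hr (by nlinarith)
    nlinarith
  linarith

lemma core {E : Type*} [NormedAddCommGroup E] [InnerProductSpace ℝ E] {n : ℕ}
    (p : Fin n → ℝ) (c : Fin n → E) (hp : ∀ i, p i ∈ Set.Ioo (0:ℝ) 1)
    (w : E) (hw : w ≠ 0) (Lc lmin lmax : ℝ) (hLc : ∀ i, ‖c i‖ ≤ Lc) (hl : 0 < lmin)
    (hll : lmin ≤ lmax)
    (hlo : ∀ v : E, lmin * ‖v‖ ^ 2 ≤ ∑ i, p i * (1 - p i) * ⟪v, c i⟫ ^ 2)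
    (hhi : ∀ v : E, ∑ i, p i * (1 - p i) * ⟪v, c i⟫ ^ 2 ≤ lmax * ‖v‖ ^ 2)
    (u : E → ℝ)
    (hu : ∀ θ, u θ = ∑ i, p i * (1 - p i) * (⟪w, c i⟫ * ⟪θ, c i⟫) - ∑ i, phiB (p i) ⟪θ, c i⟫)
    (hsmall : ‖w‖ ≤ 1 / (3 * Lc * (lmax / lmin))) (θhat : E) (hmax : ∀ θ, u θ ≤ u θhat) :
    Real.exp (-(3 * Lc * (lmax / lmin)) * ‖w‖)
      ≤ u θhat / (1 / 2 * ∑ i, p i * (1 - p i) * ⟪w, c i⟫ ^ 2) ∧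
    u θhat / (1 / 2 * ∑ i, p i * (1 - p i) * ⟪w, c i⟫ ^ 2)
      ≤ Real.exp (3 * Lc * (lmax / lmin) * ‖w‖) := by
  have hm : ∀ i, 0 < p i * (1 - p i) := fun i => mul_pos (hp i).1 (by linarith [(hp i).2])
  have hwpos : 0 < ‖w‖ := norm_pos_iff.2 hw
  obtain ⟨κ, hκ⟩ : ∃ κ, κ = lmax / lmin := ⟨_, rfl⟩
  rw [← hκ] at hsmall ⊢
  have hκ1 : 1 ≤ κ := by rw [hκ, le_div_iff₀ hl]; linarith
  have hκm : lmax = κ * lmin := by rw [hκ]; field_simp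
  have hCpos : 0 < 3 * Lc * κ := one_div_pos.1 (hwpos.trans_le hsmall)
  have hLpos : 0 < Lc := by
    by_contra h
    push Not at h
    nlinarith
  have hε : 3 * Lc * κ * ‖w‖ ≤ 1 := by
    rw [le_div_iff₀ hCpos] at hsmall; linarith
  have hin : ∀ (θ : E) (i : Fin n), |⟪θ, c i⟫| ≤ Lc * ‖θ‖ := by
    intro θ i
    refine (abs_real_inner_le_norm θ (c i)).trans ?_
    rw [mul_comm]
    exact mul_le_mul_of_nonneg_right (hLc i) (norm_nonneg _)
  set Q : ℝ := ∑ i, p i * (1 - p i) * ⟪w, c i⟫ ^ 2 with hQ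
  have hQpos : 0 < Q := lt_of_lt_of_le (by positivity) (hlo w)
  constructor
  · have hr0 : 0 ≤ Lc * ‖w‖ := by positivity
    have hr3 : Lc * ‖w‖ ≤ Lc * ‖w‖ * κ := le_mul_of_one_le_right hr0 hκ1
    have hr1 : Lc * ‖w‖ ≤ 1 / 3 := by nlinarith
    have hnum := num_ineq hr0 hr1
    have he : Real.exp (-(3 * Lc * κ) * ‖w‖) ≤ Real.exp (-(3 * (Lc * ‖w‖))) := by
      apply Real.exp_le_exp.2; nlinarith
    have huw : Q - Real.exp (Lc * ‖w‖) / 2 * Q ≤ u w := by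
      rw [hu w]
      have : ∑ i, phiB (p i) ⟪w, c i⟫ ≤ Real.exp (Lc * ‖w‖) / 2 * Q := by
        rw [hQ, Finset.mul_sum]
        apply Finset.sum_le_sum
        intro i _
        refine (phiB_upper (hp i) (hin w i)).trans (le_of_eq ?_)
        ring
      have h2 : ∑ i, p i * (1 - p i) * (⟪w, c i⟫ * ⟪w, c i⟫) = Q := by
        rw [hQ]; apply Finset.sum_congr rfl; intro i _; ring
      linarith
    rw [le_div_iff₀ (by positivity)]
    have := hmax w
    have := mul_le_mul_of_nonneg_right (he.trans hnum) (show 0 ≤ 1 / 2 * Q by positivity)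
    nlinarith
  · obtain ⟨R, hR⟩ : ∃ R, R = 3 * κ * ‖w‖ := ⟨_, rfl⟩
    have hRpos : 0 < R := by rw [hR]; positivity
    have hLR : Lc * R = 3 * Lc * κ * ‖w‖ := by rw [hR]; ring
    have hθ : ‖θhat‖ ≤ R := by
      by_contra hcon
      push Not at hcon
      have htpos : 0 < ‖θhat‖ := hRpos.trans hcon
      obtain ⟨s, hs⟩ : ∃ s, s = R / ‖θhat‖ := ⟨_, rfl⟩
      have hs0 : 0 ≤ s := by rw [hs]; positivity
      have hs1 : s ≤ 1 := by rw [hs, div_le_one htpos]; exact hcon.le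
      obtain ⟨θ, hθ⟩ : ∃ θ, θ = s • θhat := ⟨_, rfl⟩
      have hθn : ‖θ‖ = R := by
        rw [hθ, norm_smul, Real.norm_of_nonneg hs0, hs]; field_simp
      have hθc : ∀ i, ⟪θ, c i⟫ = s * ⟪θhat, c i⟫ := by
        intro i; rw [hθ, real_inner_smul_left]
      have hu0 : 0 ≤ u θhat := by
        have h := hmax 0
        rw [hu 0] at h
        simpa [phiB_zero] using h
      have h1 : 0 ≤ u θ := by
        have : s * u θhat ≤ u θ := by
          rw [hu, hu θ, mul_sub, Finset.mul_sum, Finset.mul_sum]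
          apply sub_le_sub
          · apply le_of_eq
            apply Finset.sum_congr rfl
            intro i _
            rw [hθc]; ring
          · apply Finset.sum_le_sum
            intro i _
            rw [hθc]
            exact phiB_smul (hp i) hs0 hs1 _
        exact (mul_nonneg hs0 hu0).trans this
      have h2 : 17 / 48 * (lmin * R ^ 2) ≤ ∑ i, phiB (p i) ⟪θ, c i⟫ := by
        have := hlo θ
        rw [hθn] at this
        refine (mul_le_mul_of_nonneg_left this (by norm_num)).trans ?_
        rw [Finset.mul_sum]
        apply Finset.sum_le_sum
        intro i _
        refine le_trans (le_of_eq ?_) (phiB_lower2 (hp i) (t := ⟪θ, c i⟫) ?_)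
        · ring
        · refine (hin θ i).trans ?_
          rw [hθn, hLR]; exact hε
      have h3 : ∑ i, p i * (1 - p i) * (⟪w, c i⟫ * ⟪θ, c i⟫) ≤ lmax * (‖w‖ * R) := by
        obtain ⟨k, hk⟩ : ∃ k, k = 3 * κ := ⟨_, rfl⟩
        have hkpos : 0 < k := by rw [hk]; positivity
        have hRk : R = k * ‖w‖ := by rw [hR, hk]
        have : ∑ i, p i * (1 - p i) * (⟪w, c i⟫ * ⟪θ, c i⟫) ≤
            k / 2 * Q + 1 / (2 * k) * ∑ i, p i * (1 - p i) * ⟪θ, c i⟫ ^ 2 := by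
          rw [hQ, Finset.mul_sum, Finset.mul_sum, ← Finset.sum_add_distrib]
          apply Finset.sum_le_sum
          intro i _
          have h : ⟪w, c i⟫ * ⟪θ, c i⟫ ≤ k / 2 * ⟪w, c i⟫ ^ 2 + 1 / (2 * k) * ⟪θ, c i⟫ ^ 2 := by
            have h5 : k / 2 * ⟪w, c i⟫ ^ 2 + 1 / (2 * k) * ⟪θ, c i⟫ ^ 2 - ⟪w, c i⟫ * ⟪θ, c i⟫
              = 1 / (2 * k) * (k * ⟪w, c i⟫ - ⟪θ, c i⟫) ^ 2 := by
              field_simp; ring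
            have : 0 ≤ 1 / (2 * k) * (k * ⟪w, c i⟫ - ⟪θ, c i⟫) ^ 2 := by positivity
            linarith
          have := mul_le_mul_of_nonneg_left h (hm i).le
          linarith
        refine this.trans ?_
        have ha := mul_le_mul_of_nonneg_left (hhi w) (show 0 ≤ k / 2 by positivity)
        have hb := mul_le_mul_of_nonneg_left (hhi θ) (show 0 ≤ 1 / (2 * k) by positivity)
        rw [hθn] at hb
        refine (add_le_add ha hb).trans (le_of_eq ?_)
        rw [hRk]; field_simp; ring
      rw [hu θ] at h1
      have h4 : lmax * (‖w‖ * R) = 1 / 3 * (lmin * R ^ 2) := by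
        rw [hκm, hR]; ring
      have : 0 < lmin * R ^ 2 := by positivity
      linarith
    rw [div_le_iff₀ (by positivity), ← hLR]
    rw [hu θhat, Finset.mul_sum, ← Finset.sum_sub_distrib, Finset.mul_sum]
    apply Finset.sum_le_sum
    intro i _
    have h1 := phiB_lower (hp i) ((hin θhat i).trans (mul_le_mul_of_nonneg_left hθ hLpos.le))
    have h2 : ⟪w, c i⟫ * ⟪θhat, c i⟫ ≤ Real.exp (Lc * R) / 2 * ⟪w, c i⟫ ^ 2 +
        Real.exp (-(Lc * R)) * ⟪θhat, c i⟫ ^ 2 / 2 := by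
      have hk := Real.exp_pos (Lc * R)
      rw [Real.exp_neg]
      generalize Real.exp (Lc * R) = k at *
      have h5 : k / 2 * ⟪w, c i⟫ ^ 2 + k⁻¹ * ⟪θhat, c i⟫ ^ 2 / 2 - ⟪w, c i⟫ * ⟪θhat, c i⟫
        = 1 / (2 * k) * (k * ⟪w, c i⟫ - ⟪θhat, c i⟫) ^ 2 := by
        field_simp; ring
      have : 0 ≤ 1 / (2 * k) * (k * ⟪w, c i⟫ - ⟪θhat, c i⟫) ^ 2 := by positivity
      linarith
    have := mul_le_mul_of_nonneg_left h2 (hm i).le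
    linarith

lemma inner_eq_dot {d : ℕ} (v c : EuclideanSpace ℝ (Fin d)) :
    ⟪v, c⟫ = (fun j => c j) ⬝ᵥ (fun j => v j) := by
  simp [PiLp.inner_apply, dotProduct]

lemma V_mulVec {d n : ℕ} (p : Fin n → ℝ) (c : Fin n → EuclideanSpace ℝ (Fin d))
    (v θ : EuclideanSpace ℝ (Fin d)) :
    (fun j => θ j) ⬝ᵥ ((∑ i, (p i * (1 - p i)) •
      Matrix.vecMulVec (fun j => c i j) (fun j => c i j)) *ᵥ (fun j => v j))
    = ∑ i, p i * (1 - p i) * (⟪v, c i⟫ * ⟪θ, c i⟫) := by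
  rw [Matrix.sum_mulVec, dotProduct_sum]
  apply Finset.sum_congr rfl
  intro i _
  rw [Matrix.smul_mulVec, dotProduct_smul, Matrix.vecMulVec_mulVec, inner_eq_dot, inner_eq_dot,
    dotProduct_comm (fun j => c i j) (fun j => θ j)]
  simp [mul_comm]

lemma quad_lower {d : ℕ} {V : Matrix (Fin d) (Fin d) ℝ} (hV : V.IsHermitian) {l : ℝ}
    (h : ∀ y ∈ spectrum ℝ V, l ≤ y) (v : Fin d → ℝ) : l * (v ⬝ᵥ v) ≤ v ⬝ᵥ (V *ᵥ v) := by
  have hps : (V - algebraMap ℝ _ l).PosSemidef := by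
    rw [Matrix.posSemidef_iff_isHermitian_and_spectrum_nonneg]
    refine ⟨hV.sub ?_, ?_⟩
    · rw [Matrix.IsHermitian, Matrix.algebraMap_eq_diagonal, Matrix.diagonal_conjTranspose]
      simp
    · intro y hy
      rw [← spectrum.sub_singleton_eq] at hy
      obtain ⟨a, ha, b, hb, rfl⟩ := hy
      rw [Set.mem_singleton_iff.1 hb]
      exact sub_nonneg.2 (h a ha)
  have := hps.dotProduct_mulVec_nonneg v
  rw [Matrix.sub_mulVec, dotProduct_sub, Algebra.algebraMap_eq_smul_one, Matrix.smul_mulVec,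
    Matrix.one_mulVec, dotProduct_smul] at this
  simpa using this

lemma quad_upper {d : ℕ} {V : Matrix (Fin d) (Fin d) ℝ} (hV : V.IsHermitian) {l : ℝ}
    (h : ∀ y ∈ spectrum ℝ V, y ≤ l) (v : Fin d → ℝ) : v ⬝ᵥ (V *ᵥ v) ≤ l * (v ⬝ᵥ v) := by
  have := quad_lower (V := -V) (l := -l) hV.neg (by
    intro y hy
    rw [← spectrum.neg_eq, Set.mem_neg] at hy
    linarith [h _ hy]) v
  rw [Matrix.neg_mulVec, dotProduct_neg] at this
  linarith

/-- Behavior of the hindsight strategy: under `‖V_n⁻¹S_n‖ ≤ 1/(3L_cL_λ)`,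
`e^{-C‖V_n⁻¹S_n‖} ≤ (max_θ log K_n^θ)/((1/2)S_n'V_n⁻¹S_n) ≤ e^{C‖V_n⁻¹S_n‖}`
with `C = 3L_cL_λ`. -/
theorem hindsight_capital_bounds {d n : ℕ} (hn : 0 < n)
    (p x : Fin n → ℝ) (c : Fin n → EuclideanSpace ℝ (Fin d))
    (hp : ∀ i, p i ∈ Set.Ioo (0:ℝ) 1)
    (hx : ∀ i, x i = 0 ∨ x i = 1)
    (V : Matrix (Fin d) (Fin d) ℝ)
    (hV : V = ∑ i, (p i * (1 - p i)) •
      Matrix.vecMulVec (fun j => c i j) (fun j => c i j))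
    (hVpd : V.PosDef)
    (S : Fin d → ℝ) (hS : S = ∑ i, (x i - p i) • (fun j => c i j))
    (hSne : S ≠ 0)
    (Lc : ℝ) (hLc : IsGreatest (Set.range fun i => ‖c i‖) Lc)
    (lmin lmax : ℝ)
    (hlmin : IsLeast (spectrum ℝ V) lmin)
    (hlmax : IsGreatest (spectrum ℝ V) lmax)
    (hlminpos : 0 < lmin)
    (u : EuclideanSpace ℝ (Fin d) → ℝ)
    (hu : ∀ θ, u θ = ⟪θ, ∑ i, x i • c i⟫
        - ∑ i, Real.log (1 + p i * (Real.exp ⟪θ, c i⟫ - 1)))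
    (hsmall : ‖(EuclideanSpace.equiv (Fin d) ℝ).symm (V⁻¹ *ᵥ S)‖
        ≤ 1 / (3 * Lc * (lmax / lmin)))
    (θhat : EuclideanSpace ℝ (Fin d)) (hmax : ∀ θ, u θ ≤ u θhat) :
    Real.exp (-(3 * Lc * (lmax / lmin))
        * ‖(EuclideanSpace.equiv (Fin d) ℝ).symm (V⁻¹ *ᵥ S)‖)
      ≤ u θhat / (1 / 2 * (S ⬝ᵥ V⁻¹ *ᵥ S)) ∧
    u θhat / (1 / 2 * (S ⬝ᵥ V⁻¹ *ᵥ S))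
      ≤ Real.exp (3 * Lc * (lmax / lmin)
        * ‖(EuclideanSpace.equiv (Fin d) ℝ).symm (V⁻¹ *ᵥ S)‖) := by
  have hnorm : ∀ v : EuclideanSpace ℝ (Fin d), (fun j => v j) ⬝ᵥ (fun j => v j) = ‖v‖ ^ 2 := by
    intro v
    rw [← real_inner_self_eq_norm_sq, inner_eq_dot]
  have hunit : IsUnit V.det := (Matrix.isUnit_iff_isUnit_det V).1 hVpd.isUnit
  obtain ⟨w, hw⟩ : ∃ w, w = (EuclideanSpace.equiv (Fin d) ℝ).symm (V⁻¹ *ᵥ S) := ⟨_, rfl⟩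
  have hwf : (fun j => w j) = V⁻¹ *ᵥ S := by rw [hw]; rfl
  have hVw : V *ᵥ (fun j => w j) = S := by
    rw [hwf, Matrix.mulVec_mulVec, Matrix.mul_nonsing_inv _ hunit, Matrix.one_mulVec]
  have hw0 : w ≠ 0 := by
    intro h
    apply hSne
    rw [← hVw, h]
    exact Matrix.mulVec_zero V
  have hform : ∀ v θ : EuclideanSpace ℝ (Fin d), (fun j => θ j) ⬝ᵥ (V *ᵥ (fun j => v j))
      = ∑ i, p i * (1 - p i) * (⟪v, c i⟫ * ⟪θ, c i⟫) := by
    intro v θ; rw [hV]; exact V_mulVec p c v θ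
  have hform2 : ∀ v : EuclideanSpace ℝ (Fin d), (fun j => v j) ⬝ᵥ (V *ᵥ (fun j => v j))
      = ∑ i, p i * (1 - p i) * ⟪v, c i⟫ ^ 2 := by
    intro v; rw [hform]; simp only [sq]
  have hQ : S ⬝ᵥ V⁻¹ *ᵥ S = ∑ i, p i * (1 - p i) * ⟪w, c i⟫ ^ 2 := by
    rw [← hform2, hVw, hwf, dotProduct_comm]
  rw [← hw] at hsmall ⊢
  rw [hQ]
  refine core p c hp w hw0 Lc lmin lmax (fun i => hLc.2 ⟨i, rfl⟩) hlminpos (hlmin.2 hlmax.1)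
    ?_ ?_ u ?_ hsmall θhat hmax
  · intro v
    rw [← hform2, ← hnorm]
    exact quad_lower hVpd.1 (fun y hy => hlmin.2 hy) _
  · intro v
    rw [← hform2, ← hnorm]
    exact quad_upper hVpd.1 (fun y hy => hlmax.2 hy) _
  · intro θ
    rw [hu, ← hform, hVw, hS, dotProduct_sum, inner_sum]
    simp only [phiB, Finset.sum_sub_distrib]
    have : ∀ i, (fun j => θ j) ⬝ᵥ ((x i - p i) • (fun j => c i j))
        = ⟪θ, x i • c i⟫ - p i * ⟪θ, c i⟫ := by
      intro i
      rw [dotProduct_smul, dotProduct_comm, ← inner_eq_dot, real_inner_smul_right, smul_eq_mul]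
      ring
    simp only [this, Finset.sum_sub_distrib]
    ring
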